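/- Let f : ℝ³ → ℝ be a smooth (C^∞) compactly supported function and define the Newtonian potential u(r) = ∫_{ℝ³} f(r')/‖r − r'‖ dr'. Then u is twice continuously differentiable on ℝ³ and satisfies Δu = −4π f everywhere on ℝ³. -/

import Mathlib

open MeasureTheory Real

noncomputable section

/-- ℝ³ with the Euclidean norm. -/
abbrev E3 : Type := EuclideanSpace ℝ (Fin 3)

/-- The `i`-th partial derivative of a scalar field on ℝ³. -/
def pd (i : Fin 3) (f : E3 → ℝ) (x : E3) : ℝ :=
  fderiv ℝ f x (EuclideanSpace.single i 1)

/-- Divergence of a vector field on ℝ³: div A = ∂₁A₁ + ∂₂A₂ + ∂₃A₃. -/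
def div3 (F : E3 → E3) (x : E3) : ℝ :=
  pd 0 (fun y => F y 0) x + pd 1 (fun y => F y 1) x + pd 2 (fun y => F y 2) x

/-- Curl of a vector field on ℝ³:
curl A = (∂₂A₃ − ∂₃A₂, ∂₃A₁ − ∂₁A₃, ∂₁A₂ − ∂₂A₁). -/
def curl3 (F : E3 → E3) (x : E3) : E3 :=
  (WithLp.equiv 2 (Fin 3 → ℝ)).symm
    ![pd 1 (fun y => F y 2) x - pd 2 (fun y => F y 1) x,
      pd 2 (fun y => F y 0) x - pd 0 (fun y => F y 2) x,
      pd 0 (fun y => F y 1) x - pd 1 (fun y => F y 0) x]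

/-- Gradient of a scalar field on ℝ³: ∇Φ = (∂₁Φ, ∂₂Φ, ∂₃Φ). -/
def grad3 (f : E3 → ℝ) (x : E3) : E3 :=
  (WithLp.equiv 2 (Fin 3 → ℝ)).symm ![pd 0 f x, pd 1 f x, pd 2 f x]

/-- Laplacian of a scalar field on ℝ³: ΔΦ = ∂₁²Φ + ∂₂²Φ + ∂₃²Φ. -/
def lap3 (f : E3 → ℝ) (x : E3) : ℝ :=
  pd 0 (pd 0 f) x + pd 1 (pd 1 f) x + pd 2 (pd 2 f) x

/-- Cross product on ℝ³. -/
def cross3 (a b : E3) : E3 :=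
  (WithLp.equiv 2 (Fin 3 → ℝ)).symm
    ![a 1 * b 2 - a 2 * b 1, a 2 * b 0 - a 0 * b 2, a 0 * b 1 - a 1 * b 0]

/-- The Newtonian potential of a density f: u(r) = ∫ f(r')/‖r − r'‖ dr'. -/
def newtonianPotential (f : E3 → ℝ) (r : E3) : ℝ :=
  ∫ r' : E3, f r' / ‖r - r'‖

open Filter Topology Set in
theorem integral_sq_mul_inv_sqrt_pow_five :
    ∫ y in Ioi (0 : ℝ), y ^ 2 * (√(y ^ 2 + 1) ^ 5)⁻¹ = 1 / 3 := by
  have hs (y : ℝ) : 0 < √(y ^ 2 + 1) := Real.sqrt_pos.2 (by positivity)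
  have hderiv (y : ℝ) : HasDerivAt (fun y : ℝ => (y / √(y ^ 2 + 1)) ^ 3 / 3)
      (y ^ 2 * (√(y ^ 2 + 1) ^ 5)⁻¹) y := by
    have h1 : HasDerivAt (fun y : ℝ => √(y ^ 2 + 1)) (2 * y / (2 * √(y ^ 2 + 1))) y := by
      have := ((hasDerivAt_pow 2 y).add_const 1).sqrt (by positivity)
      simpa using this
    convert! ((((hasDerivAt_id y).div h1 (hs y).ne').pow 3).div_const 3) using 1
    have h2 : √(y ^ 2 + 1) ^ 2 = y ^ 2 + 1 := Real.sq_sqrt (by positivity)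
    have h3 := (hs y).ne'
    simp only [Pi.div_apply, id, Nat.cast_ofNat, Nat.add_one_sub_one]
    generalize √(y ^ 2 + 1) = s at *
    field_simp
    linear_combination -y ^ 2 * h2
  have hlim : Tendsto (fun y : ℝ => (y / √(y ^ 2 + 1)) ^ 3 / 3) atTop (𝓝 (1 / 3)) := by
    have h1 : Tendsto (fun y : ℝ => (√(1 + (y ^ 2)⁻¹))⁻¹ ^ 3 / 3) atTop
        (𝓝 ((√(1 + 0))⁻¹ ^ 3 / 3)) := by
      have h0 : Tendsto (fun y : ℝ => (y ^ 2)⁻¹) atTop (𝓝 0) :=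
        (tendsto_pow_atTop two_ne_zero).inv_tendsto_atTop
      exact ((((h0.const_add 1).sqrt).inv₀ (by simp)).pow 3).div_const 3
    simp only [add_zero, Real.sqrt_one, inv_one, one_pow] at h1
    refine h1.congr' ?_
    filter_upwards [eventually_gt_atTop 0] with y hy
    have : y ^ 2 + 1 = y ^ 2 * (1 + (y ^ 2)⁻¹) := by field_simp
    rw [this, Real.sqrt_mul (by positivity), Real.sqrt_sq hy.le]
    congr 2
    field_simp
  rw [integral_Ioi_of_hasDerivAt_of_nonneg' (fun y _ => hderiv y) (fun y _ => by positivity) hlim]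
  simp

theorem integral_inv_sqrt_norm_sq_add_one_pow_five :
    ∫ x : E3, (√(‖x‖ ^ 2 + 1) ^ 5)⁻¹ = 4 * π / 3 := by
  rw [integral_fun_norm_addHaar volume (fun y : ℝ => (√(y ^ 2 + 1) ^ 5)⁻¹)]
  simp only [finrank_euclideanSpace_fin, smul_eq_mul, Nat.add_one_sub_one,
    integral_sq_mul_inv_sqrt_pow_five, Measure.real, EuclideanSpace.volume_ball_fin_three]
  rw [ENNReal.toReal_mul, ENNReal.toReal_ofReal (by positivity)]
  simp
  ring

theorem locallyIntegrable_inv_norm : LocallyIntegrable (fun x : E3 => ‖x‖⁻¹) := by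
  rw [locallyIntegrable_iff]
  intro k hk
  obtain ⟨R, hR⟩ := hk.isBounded.subset_ball 0
  refine IntegrableOn.mono_set ?_ hR
  rw [integrableOn_fun_norm_addHaar volume (f := fun y : ℝ => y⁻¹)]
  have h1 : IntegrableOn (fun y : ℝ => y) (Set.Ioo 0 R) :=
    (continuous_id.integrableOn_Icc).mono_set Set.Ioo_subset_Icc_self
  refine h1.congr_fun (fun y hy => ?_) measurableSet_Ioo
  have := hy.1.ne'
  simp only [finrank_euclideanSpace_fin, smul_eq_mul, Nat.add_one_sub_one]
  field_simp

theorem contDiff_pd {n : ℕ∞} (i : Fin 3) {f : E3 → ℝ} (hf : ContDiff ℝ (n + 1) f) :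
    ContDiff ℝ n (pd i f) :=
  (hf.fderiv_right le_rfl).clm_apply contDiff_const

theorem HasCompactSupport.pd (i : Fin 3) {f : E3 → ℝ} (hf : HasCompactSupport f) :
    HasCompactSupport (pd i f) :=
  hf.fderiv_apply ℝ _

theorem integral_mul_pd_eq_neg (i : Fin 3) {k g : E3 → ℝ} (hk : ContDiff ℝ 1 k)
    (hg : ContDiff ℝ 1 g) (hgs : HasCompactSupport g) :
    ∫ x, k x * pd i g x = -∫ x, pd i k x * g x := by
  have hk' : Continuous (pd i k) := (contDiff_pd (n := 0) i (by simpa using hk)).continuous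
  have hg' : Continuous (pd i g) := (contDiff_pd (n := 0) i (by simpa using hg)).continuous
  refine integral_mul_fderiv_eq_neg_fderiv_mul_of_integrable ?_ ?_ ?_
    (fun x _ => hk.differentiable one_ne_zero x) (fun x _ => hg.differentiable one_ne_zero x)
  · exact (hk'.mul hg.continuous).integrable_of_hasCompactSupport hgs.mul_left
  · exact (hk.continuous.mul hg').integrable_of_hasCompactSupport (hgs.pd i).mul_left
  · exact (hk.continuous.mul hg.continuous).integrable_of_hasCompactSupport hgs.mul_left

theorem integral_mul_pd_pd (i : Fin 3) {k g : E3 → ℝ} (hk : ContDiff ℝ 2 k)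
    (hg : ContDiff ℝ 2 g) (hgs : HasCompactSupport g) :
    ∫ x, k x * pd i (pd i g) x = ∫ x, pd i (pd i k) x * g x := by
  have hk' : ContDiff ℝ 1 (pd i k) :=
    contDiff_pd (n := 1) i (by simpa [one_add_one_eq_two] using hk)
  have hg' : ContDiff ℝ 1 (pd i g) :=
    contDiff_pd (n := 1) i (by simpa [one_add_one_eq_two] using hg)
  rw [integral_mul_pd_eq_neg i (hk.of_le one_le_two) hg' (hgs.pd i),
    integral_mul_pd_eq_neg i hk' (hg.of_le one_le_two) hgs, neg_neg]

theorem continuous_pd_pd (i : Fin 3) {g : E3 → ℝ} (hg : ContDiff ℝ 2 g) :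
    Continuous (pd i (pd i g)) :=
  (contDiff_pd (n := 0) i (by
    simpa using contDiff_pd (n := 1) i (by simpa [one_add_one_eq_two] using hg))).continuous

theorem continuous_lap3 {g : E3 → ℝ} (hg : ContDiff ℝ 2 g) : Continuous (lap3 g) :=
  ((continuous_pd_pd 0 hg).add (continuous_pd_pd 1 hg)).add (continuous_pd_pd 2 hg)

theorem HasCompactSupport.lap3 {g : E3 → ℝ} (hg : HasCompactSupport g) :
    HasCompactSupport (lap3 g) :=
  (((hg.pd 0).pd 0).add ((hg.pd 1).pd 1)).add ((hg.pd 2).pd 2)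

/-- **Green's second identity** when one of the functions has compact support. -/
theorem integral_mul_lap3 {k g : E3 → ℝ} (hk : ContDiff ℝ 2 k)
    (hg : ContDiff ℝ 2 g) (hgs : HasCompactSupport g) :
    ∫ x, k x * lap3 g x = ∫ x, lap3 k x * g x := by
  have h1 (i : Fin 3) : Integrable (fun x => k x * pd i (pd i g) x) :=
    (hk.continuous.mul (continuous_pd_pd i hg)).integrable_of_hasCompactSupport
      ((hgs.pd i).pd i).mul_left
  have h2 (i : Fin 3) : Integrable (fun x => pd i (pd i k) x * g x) :=
    ((continuous_pd_pd i hk).mul hg.continuous).integrable_of_hasCompactSupport hgs.mul_left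
  simp only [lap3, mul_add, add_mul]
  rw [integral_add ((h1 0).fun_add (h1 1)) (h1 2), integral_add (h1 0) (h1 1),
    integral_add ((h2 0).fun_add (h2 1)) (h2 2), integral_add (h2 0) (h2 1)]
  simp only [integral_mul_pd_pd _ hk hg hgs]

theorem hasFDerivAt_sqrt_norm_sq_add {a : ℝ} (ha : 0 < a) (x : E3) :
    HasFDerivAt (fun x : E3 => √(‖x‖ ^ 2 + a)) ((√(‖x‖ ^ 2 + a))⁻¹ • innerSL ℝ x) x := by
  convert! (((hasFDerivAt_id x).norm_sq).add_const a).sqrt (by positivity) using 1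
  ext v
  simp
  ring

theorem pd_inv_sqrt_norm_sq_add {a : ℝ} (ha : 0 < a) (i : Fin 3) :
    pd i (fun x : E3 => (√(‖x‖ ^ 2 + a))⁻¹) = fun x => -(x i * (√(‖x‖ ^ 2 + a) ^ 3)⁻¹) := by
  ext x
  have hs : 0 < √(‖x‖ ^ 2 + a) := Real.sqrt_pos.2 (by positivity)
  have h := (hasDerivAt_inv hs.ne').comp_hasFDerivAt x (hasFDerivAt_sqrt_norm_sq_add ha x)
  rw [pd, HasFDerivAt.fderiv (f := fun x : E3 => (√(‖x‖ ^ 2 + a))⁻¹) h]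
  simp [EuclideanSpace.inner_single_right]
  field_simp

theorem pd_pd_inv_sqrt_norm_sq_add {a : ℝ} (ha : 0 < a) (i : Fin 3) (x : E3) :
    pd i (pd i (fun x : E3 => (√(‖x‖ ^ 2 + a))⁻¹)) x =
      3 * x i ^ 2 * (√(‖x‖ ^ 2 + a) ^ 5)⁻¹ - (√(‖x‖ ^ 2 + a) ^ 3)⁻¹ := by
  rw [pd_inv_sqrt_norm_sq_add ha]
  have hs : 0 < √(‖x‖ ^ 2 + a) := Real.sqrt_pos.2 (by positivity)
  have h1 := ((hasDerivAt_pow 3 √(‖x‖ ^ 2 + a)).fun_inv (pow_pos hs 3).ne').comp_hasFDerivAt x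
    (hasFDerivAt_sqrt_norm_sq_add ha x)
  have h2 : HasFDerivAt (fun x : E3 => x i) (EuclideanSpace.proj i : E3 →L[ℝ] ℝ) x :=
    (EuclideanSpace.proj i : E3 →L[ℝ] ℝ).hasFDerivAt
  have h := (h2.mul h1).neg
  rw [pd, HasFDerivAt.fderiv (f := fun x : E3 => -(x i * (√(‖x‖ ^ 2 + a) ^ 3)⁻¹)) h]
  simp [EuclideanSpace.inner_single_right]
  field_simp
  ring

theorem lap3_inv_sqrt_norm_sq_add {a : ℝ} (ha : 0 < a) (x : E3) :
    lap3 (fun x : E3 => (√(‖x‖ ^ 2 + a))⁻¹) x = -(3 * a * (√(‖x‖ ^ 2 + a) ^ 5)⁻¹) := by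
  have hs : 0 < √(‖x‖ ^ 2 + a) := Real.sqrt_pos.2 (by positivity)
  have h2 : √(‖x‖ ^ 2 + a) ^ 2 = ‖x‖ ^ 2 + a := Real.sq_sqrt (by positivity)
  have h3 : ‖x‖ ^ 2 = x 0 ^ 2 + x 1 ^ 2 + x 2 ^ 2 := by
    simp [EuclideanSpace.norm_sq_eq, Fin.sum_univ_three]
  simp only [lap3, pd_pd_inv_sqrt_norm_sq_add ha]
  generalize √(‖x‖ ^ 2 + a) = s at *
  rw [h3] at h2
  field_simp
  linear_combination -3 * h2

theorem contDiff_inv_sqrt_norm_sq_add {a : ℝ} (ha : 0 < a) :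
    ContDiff ℝ 2 (fun x : E3 => (√(‖x‖ ^ 2 + a))⁻¹) := by
  have h (x : E3) : 0 < ‖x‖ ^ 2 + a := by positivity
  exact (((contDiff_norm_sq ℝ).add contDiff_const).sqrt fun x => (h x).ne').inv
    fun x => (Real.sqrt_pos.2 (h x)).ne'

open Filter Topology in
/-- The functions `3 / (4π) c³ (‖c x‖² + 1)^(-5/2)` are an approximate identity as `c → ∞`. -/
theorem tendsto_integral_peak {g : E3 → ℝ} (hg : Continuous g) (hgs : HasCompactSupport g) :
    Tendsto (fun c : ℝ => ∫ x : E3, (c ^ 3 * (3 / (4 * π) * (√(‖c • x‖ ^ 2 + 1) ^ 5)⁻¹)) * g x)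
      atTop (𝓝 (g 0)) := by
  have key := tendsto_integral_comp_smul_smul_of_integrable (μ := (volume : Measure E3))
    (φ := fun x : E3 => 3 / (4 * π) * (√(‖x‖ ^ 2 + 1) ^ 5)⁻¹) (g := g)
    (fun x => by positivity)
    (by
      rw [integral_const_mul, integral_inv_sqrt_norm_sq_add_one_pow_five]
      field_simp)
    (by
      have h0 : Tendsto (fun x : E3 => 3 / (4 * π) * ‖x‖⁻¹) (Bornology.cobounded E3) (𝓝 0) := by
        simpa using (tendsto_norm_cobounded_atTop.inv_tendsto_atTop.const_mul (3 / (4 * π)))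
      refine squeeze_zero' (Eventually.of_forall fun x => by positivity) ?_ h0
      filter_upwards [tendsto_norm_cobounded_atTop.eventually_ge_atTop (1 : ℝ)] with x hx
      have h1 : ‖x‖ ≤ √(‖x‖ ^ 2 + 1) := Real.le_sqrt_of_sq_le (by linarith)
      have hx0 : 0 < ‖x‖ := by linarith
      have h2 : (√(‖x‖ ^ 2 + 1) ^ 5)⁻¹ ≤ (‖x‖ ^ 5)⁻¹ := by gcongr
      have h3 : ‖x‖ ^ 3 * (‖x‖ ^ 5)⁻¹ ≤ ‖x‖⁻¹ := by
        field_simp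
        exact hx
      simp only [finrank_euclideanSpace_fin]
      calc ‖x‖ ^ 3 * (3 / (4 * π) * (√(‖x‖ ^ 2 + 1) ^ 5)⁻¹)
          ≤ ‖x‖ ^ 3 * (3 / (4 * π) * (‖x‖ ^ 5)⁻¹) := by gcongr
        _ = 3 / (4 * π) * (‖x‖ ^ 3 * (‖x‖ ^ 5)⁻¹) := by ring
        _ ≤ _ := by gcongr)
    (hg.integrable_of_hasCompactSupport hgs) hg.continuousAt
  simpa using key

theorem lap3_inv_sqrt_norm_sq_add_inv_sq {c : ℝ} (hc : 0 < c) (x : E3) :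
    lap3 (fun x : E3 => (√(‖x‖ ^ 2 + (c ^ 2)⁻¹))⁻¹) x =
      -(4 * π) * (c ^ 3 * (3 / (4 * π) * (√(‖c • x‖ ^ 2 + 1) ^ 5)⁻¹)) := by
  have hs : 0 < √(‖x‖ ^ 2 + (c ^ 2)⁻¹) := Real.sqrt_pos.2 (by positivity)
  have h : √(‖c • x‖ ^ 2 + 1) = c * √(‖x‖ ^ 2 + (c ^ 2)⁻¹) := by
    rw [norm_smul, Real.norm_of_nonneg hc.le]
    have : (c * ‖x‖) ^ 2 + 1 = c ^ 2 * (‖x‖ ^ 2 + (c ^ 2)⁻¹) := by field_simp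
    rw [this, Real.sqrt_mul (by positivity), Real.sqrt_sq hc.le]
  rw [lap3_inv_sqrt_norm_sq_add (by positivity), h]
  field_simp

open Filter Topology in
theorem tendsto_integral_inv_sqrt_norm_sq_add_mul {g : E3 → ℝ} (hg : Continuous g)
    (hgs : HasCompactSupport g) :
    Tendsto (fun c : ℝ => ∫ x : E3, (√(‖x‖ ^ 2 + (c ^ 2)⁻¹))⁻¹ * g x) atTop
      (𝓝 (∫ x : E3, ‖x‖⁻¹ * g x)) := by
  have hint : Integrable (fun x : E3 => ‖x‖⁻¹ * ‖g x‖) := by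
    simpa [mul_comm] using
      locallyIntegrable_inv_norm.integrable_smul_left_of_hasCompactSupport hg.norm hgs.norm
  have hne : ∀ᵐ x : E3, x ≠ 0 := by simp [ae_iff]
  refine tendsto_integral_filter_of_dominated_convergence _ ?_ ?_ hint ?_
  · filter_upwards [eventually_gt_atTop 0] with c hc
    exact ((contDiff_inv_sqrt_norm_sq_add (by positivity)).continuous.mul hg).aestronglyMeasurable
  · filter_upwards [eventually_gt_atTop 0] with c hc
    filter_upwards [hne] with x hx
    have hx0 : 0 < ‖x‖ := norm_pos_iff.2 hx
    have h1 : ‖x‖ ≤ √(‖x‖ ^ 2 + (c ^ 2)⁻¹) :=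
      Real.le_sqrt_of_sq_le (le_add_of_nonneg_right (by positivity))
    rw [norm_mul, Real.norm_of_nonneg (by positivity)]
    gcongr
  · filter_upwards [hne] with x hx
    have hx0 : 0 < ‖x‖ := norm_pos_iff.2 hx
    have h0 : Tendsto (fun c : ℝ => (c ^ 2)⁻¹) atTop (𝓝 0) :=
      (tendsto_pow_atTop two_ne_zero).inv_tendsto_atTop
    have h1 := (h0.const_add (‖x‖ ^ 2)).sqrt
    rw [add_zero, Real.sqrt_sq hx0.le] at h1
    exact (h1.inv₀ hx0.ne').mul_const _

open Filter Topology in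
/-- `‖x‖⁻¹` is `-4π` times a fundamental solution of the Laplacian. -/
theorem integral_inv_norm_mul_lap3 {g : E3 → ℝ} (hg : ContDiff ℝ 2 g)
    (hgs : HasCompactSupport g) :
    ∫ x : E3, ‖x‖⁻¹ * lap3 g x = -(4 * π) * g 0 := by
  refine tendsto_nhds_unique
    (tendsto_integral_inv_sqrt_norm_sq_add_mul (continuous_lap3 hg) hgs.lap3) ?_
  refine ((tendsto_integral_peak hg.continuous hgs).const_mul (-(4 * π))).congr' ?_
  filter_upwards [eventually_gt_atTop 0] with c hc
  rw [integral_mul_lap3 (contDiff_inv_sqrt_norm_sq_add (by positivity)) hg hgs,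
    ← integral_const_mul]
  simp only [lap3_inv_sqrt_norm_sq_add_inv_sq hc, mul_assoc]

open scoped Convolution

theorem newtonianPotential_eq_convolution (f : E3 → ℝ) :
    newtonianPotential f = (fun x => ‖x‖⁻¹) ⋆[ContinuousLinearMap.mul ℝ ℝ] f := by
  ext r
  rw [newtonianPotential, convolution_def, ← integral_sub_left_eq_self _ volume r]
  simp [div_eq_inv_mul]

theorem pd_newtonianPotential (i : Fin 3) {f : E3 → ℝ} (hf : ContDiff ℝ 1 f)
    (hfs : HasCompactSupport f) :
    pd i (newtonianPotential f) = newtonianPotential (pd i f) := by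
  ext r
  rw [pd, newtonianPotential_eq_convolution, newtonianPotential_eq_convolution,
    (hfs.hasFDerivAt_convolution_right _ locallyIntegrable_inv_norm hf r).fderiv,
    convolution_precompR_apply _ locallyIntegrable_inv_norm (hfs.fderiv ℝ)
      (hf.continuous_fderiv one_ne_zero)]
  rfl

theorem integrable_newtonianPotential_integrand {f : E3 → ℝ} (hf : Continuous f)
    (hfs : HasCompactSupport f) (r : E3) : Integrable fun t : E3 => ‖t‖⁻¹ * f (r - t) := by
  exact hfs.convolutionExists_right (ContinuousLinearMap.mul ℝ ℝ) locallyIntegrable_inv_norm hf r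

theorem pd_comp_sub_left (i : Fin 3) (f : E3 → ℝ) (r : E3) :
    pd i (fun t => f (r - t)) = fun t => -pd i f (r - t) := by
  ext t
  have h : (fun t => f (r - t)) =
      (fun s => f (r + s)) ∘ ContinuousLinearEquiv.neg ℝ (M := E3) := by
    ext t
    simp [sub_eq_add_neg]
  rw [pd, h, ContinuousLinearEquiv.comp_right_fderiv, fderiv_comp_add_left]
  simp [pd, sub_eq_add_neg]

theorem pd_neg (i : Fin 3) (f : E3 → ℝ) : pd i (fun t => -f t) = fun t => -pd i f t := by
  ext t
  simp [pd]

theorem lap3_comp_sub_left (f : E3 → ℝ) (r t : E3) :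
    lap3 (fun t => f (r - t)) t = lap3 f (r - t) := by
  simp only [lap3, pd_comp_sub_left, pd_neg, neg_neg]

theorem lap3_newtonianPotential {f : E3 → ℝ} (hf : ContDiff ℝ 2 f)
    (hfs : HasCompactSupport f) (r : E3) :
    lap3 (newtonianPotential f) r = ∫ t : E3, ‖t‖⁻¹ * lap3 f (r - t) := by
  have h (i : Fin 3) : pd i (pd i (newtonianPotential f)) r =
      ∫ t : E3, ‖t‖⁻¹ * pd i (pd i f) (r - t) := by
    rw [pd_newtonianPotential i (hf.of_le one_le_two) hfs, pd_newtonianPotential i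
      (contDiff_pd (n := 1) i (by simpa [one_add_one_eq_two] using hf)) (hfs.pd i),
      newtonianPotential_eq_convolution]
    rfl
  have hi (i : Fin 3) := integrable_newtonianPotential_integrand (continuous_pd_pd i hf)
    ((hfs.pd i).pd i) r
  simp only [lap3, h, mul_add]
  rw [integral_add ((hi 0).fun_add (hi 1)) (hi 2), integral_add (hi 0) (hi 1)]

/-- **Poisson equation for the Newtonian potential.** For a smooth compactly supported
f : ℝ³ → ℝ, the potential u(r) = ∫ f(r')/‖r − r'‖ dr' is C² and Δu = −4π f everywhere. -/
theorem newtonian_potential_poisson (f : E3 → ℝ)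
    (hf : ContDiff ℝ (⊤ : ℕ∞) f) (hsupp : HasCompactSupport f) :
    ContDiff ℝ 2 (newtonianPotential f) ∧
    ∀ r : E3, lap3 (newtonianPotential f) r = -(4 * Real.pi) * f r := by
  have hf2 : ContDiff ℝ 2 f := contDiff_infty.1 hf 2
  refine ⟨?_, fun r => ?_⟩
  · rw [newtonianPotential_eq_convolution]
    exact hsupp.contDiff_convolution_right (n := 2) _ locallyIntegrable_inv_norm hf2
  · rw [lap3_newtonianPotential hf2 hsupp]
    have h := integral_inv_norm_mul_lap3 (g := fun t => f (r - t))
      (hf2.comp (contDiff_const.sub contDiff_id))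
      (hsupp.comp_homeomorph (Homeomorph.subLeft r))
    simpa only [lap3_comp_sub_left, sub_zero] using h
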